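/- Let β > 0, c > 1 and n ≥ 1 (nonstandard Meixner parameters). Then the Meixner polynomial M_n(x;β,c) has n simple real roots, all lying in (−∞, −β), with the distance between any two distinct roots greater than 1. Moreover, the roots of M_n(x;β,c) and M_{n-1}(x;β,c) interlace: between any two consecutive roots of M_n(x;β,c) there is exactly one root of M_{n-1}(x;β,c), and the smallest and largest roots of M_n(x;β,c) are respectively smaller than the smallest and larger than the largest root of M_{n-1}(x;β,c). -/

import Mathlib

open Polynomial Filter

noncomputable def deltaOp (h : ℝ) (f : ℝ → ℝ) (x : ℝ) : ℝ := f (x + h) - f x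

noncomputable def nablaOp (h : ℝ) (f : ℝ → ℝ) (x : ℝ) : ℝ := f x - f (x - h)

noncomputable def forceF (h x y : ℝ) : ℝ := 1 / (2 * h) * Real.log ((y - x + h) / (y - x - h))

noncomputable def potV (h x y : ℝ) : ℝ :=
  (x - y) / (2 * h) * Real.log ((y - x + h) / (y - x - h))
    - 1 / 2 * Real.log ((y - x + h) * (y - x - h))

noncomputable def extForce (h : ℝ) (A B : Polynomial ℝ) (x : ℝ) : ℝ :=
  1 / (2 * h) * Real.log (1 + B.eval x / A.eval x)

noncomputable def energy (h : ℝ) (φ : ℝ → ℝ) {n : ℕ} (x : Fin n → ℝ) : ℝ :=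
  (∑ j, ∑ k ∈ Finset.univ.erase j, potV h (x k) (x j)) + 2 * ∑ j, φ (x j)

def GapGt (h : ℝ) {n : ℕ} (x : Fin n → ℝ) : Prop :=
  ∀ i : ℕ, ∀ hi : i + 1 < n, x ⟨i + 1, hi⟩ - x ⟨i, Nat.lt_of_succ_lt hi⟩ > h

def SatisfiesDiffEq (h : ℝ) (A B C p : Polynomial ℝ) : Prop :=
  ∀ x : ℝ,
    A.eval x * deltaOp h (nablaOp h fun t => p.eval t) x
      + B.eval x * deltaOp h (fun t => p.eval t) x + C.eval x * p.eval x = 0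

def InIoo (a b : EReal) (y : ℝ) : Prop := a < (y : EReal) ∧ (y : EReal) < b

def IsCriticalDist (h : ℝ) (A B : Polynomial ℝ) (a b : EReal) {n : ℕ}
    (x : Fin n → ℝ) : Prop :=
  StrictMono x ∧ (∀ j, InIoo a b (x j)) ∧ GapGt h x ∧
    ∀ j, (∑ k ∈ Finset.univ.erase j, forceF h (x k) (x j)) + extForce h A B (x j) = 0

def Admissible (h : ℝ) (a b : EReal) {n : ℕ} (x : Fin n → ℝ) : Prop :=
  StrictMono x ∧ (∀ j, a ≤ (x j : EReal) ∧ (x j : EReal) ≤ b) ∧ GapGt h x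

def IsEquilibrium (h : ℝ) (φ : ℝ → ℝ) (a b : EReal) {n : ℕ} (x : Fin n → ℝ) : Prop :=
  Admissible h a b x ∧ ∀ y : Fin n → ℝ, Admissible h a b y → energy h φ x ≤ energy h φ y

noncomputable def ratFn (A B : Polynomial ℝ) (x : ℝ) : ℝ := 1 + B.eval x / A.eval x

def GConvexOn (A B : Polynomial ℝ) (a b : EReal) : Prop :=
  a < b ∧
  (∀ x : ℝ, InIoo a b x → 0 < ratFn A B x) ∧
  (∀ x y : ℝ, InIoo a b x → InIoo a b y → x < y → ratFn A B y < ratFn A B x) ∧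
  (∀ a' : ℝ, a = (a' : EReal) → A.eval a' = 0) ∧
  (a = ⊥ → (Tendsto (ratFn A B) atBot atTop ∨
      ∃ L : ℝ, 1 < L ∧ Tendsto (ratFn A B) atBot (nhds L))) ∧
  (∀ b' : ℝ, b = (b' : EReal) → (A + B).eval b' = 0) ∧
  (b = ⊤ → ∃ L : ℝ, 0 ≤ L ∧ L < 1 ∧ Tendsto (ratFn A B) atTop (nhds L))

def IsPotential (h : ℝ) (A B : Polynomial ℝ) (a b : EReal) (φ : ℝ → ℝ) : Prop :=
  ∀ x : ℝ, InIoo a b x → HasDerivAt φ (-(extForce h A B x)) x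

noncomputable def partialD {n : ℕ} (f : (Fin n → ℝ) → ℝ) (j : Fin n) (z : Fin n → ℝ) : ℝ :=
  deriv (fun t => f (Function.update z j t)) (z j)

noncomputable def poch (t : ℝ) (k : ℕ) : ℝ := (ascPochhammer ℝ k).eval t

noncomputable def negXPoch (k : ℕ) : Polynomial ℝ := (ascPochhammer ℝ k).comp (-Polynomial.X)

noncomputable def charlier (n : ℕ) (a : ℝ) : Polynomial ℝ :=
  ∑ k ∈ Finset.range (n + 1),
    Polynomial.C (poch (-(n : ℝ)) k / (k.factorial : ℝ) * (-1 / a) ^ k) * negXPoch k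

noncomputable def krawtchouk (n : ℕ) (p : ℝ) (N : ℕ) : Polynomial ℝ :=
  ∑ k ∈ Finset.range (n + 1),
    Polynomial.C (poch (-(n : ℝ)) k / ((k.factorial : ℝ) * poch (-(N : ℝ)) k) * (1 / p) ^ k) *
      negXPoch k

noncomputable def meixner (n : ℕ) (β c : ℝ) : Polynomial ℝ :=
  ∑ k ∈ Finset.range (n + 1),
    Polynomial.C (poch (-(n : ℝ)) k / ((k.factorial : ℝ) * poch β k) * (1 - 1 / c) ^ k) *
      negXPoch k

noncomputable def hahn (n : ℕ) (α β : ℝ) (N : ℕ) : Polynomial ℝ :=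
  ∑ k ∈ Finset.range (n + 1),
    Polynomial.C (poch (-(n : ℝ)) k * poch ((n : ℝ) + α + β + 1) k /
        ((k.factorial : ℝ) * poch (α + 1) k * poch (-(N : ℝ)) k)) * negXPoch k

def IsRootTuple {n : ℕ} (p : Polynomial ℝ) (x : Fin n → ℝ) : Prop :=
  StrictMono x ∧ ∀ y : ℝ, p.IsRoot y ↔ ∃ j, y = x j

theorem poch_succ (t : ℝ) (k : ℕ) : poch t (k + 1) = poch t k * (t + k) :=
  ascPochhammer_succ_eval k t

theorem poch_succ_left (t : ℝ) (k : ℕ) : poch t (k + 1) = t * poch (t + 1) k := by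
  simp [poch, ascPochhammer_succ_left]

theorem poch_pos {t : ℝ} (ht : 0 < t) (k : ℕ) : 0 < poch t k :=
  ascPochhammer_pos k t ht

theorem poch_neg_natCast_eq_zero {n k : ℕ} (h : n < k) : poch (-(n : ℝ)) k = 0 :=
  ascPochhammer_eval_neg_coe_nat_of_lt h

theorem neg_one_pow_mul_poch_neg_pos {n k : ℕ} (h : k ≤ n) :
    0 < (-1) ^ k * poch (-(n : ℝ)) k := by
  induction k with
  | zero => simp [poch]
  | succ k ih =>
    have hk : (k : ℝ) < n := by exact_mod_cast h
    have := mul_pos (ih (by omega)) (sub_pos.2 hk)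
    rw [poch_succ, pow_succ]
    linarith

theorem negXPoch_eval (k : ℕ) (x : ℝ) : (negXPoch k).eval x = poch (-x) k := by
  simp [negXPoch, poch]

theorem natDegree_negXPoch (k : ℕ) : (negXPoch k).natDegree = k := by
  simp [negXPoch, natDegree_comp, ascPochhammer_natDegree]

theorem coeff_negXPoch_self (k : ℕ) : (negXPoch k).coeff k = (-1) ^ k := by
  have h : (negXPoch k).leadingCoeff = (-1) ^ k := by
    rw [negXPoch, leadingCoeff_comp (by simp), (monic_ascPochhammer ℝ k).leadingCoeff,
      ascPochhammer_natDegree]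
    simp
  rwa [leadingCoeff, natDegree_negXPoch] at h

noncomputable def meixnerCoeff (n : ℕ) (β z : ℝ) (k : ℕ) : ℝ :=
  poch (-(n : ℝ)) k / ((k.factorial : ℝ) * poch β k) * z ^ k

theorem meixnerCoeff_eq_zero {n k : ℕ} (β z : ℝ) (h : n < k) : meixnerCoeff n β z k = 0 := by
  simp [meixnerCoeff, poch_neg_natCast_eq_zero h]

theorem meixner_eval_eq_sum {n N : ℕ} (β c x : ℝ) (h : n < N) :
    (meixner n β c).eval x =
      ∑ k ∈ Finset.range N, meixnerCoeff n β (1 - 1 / c) k * poch (-x) k := by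
  rw [meixner, eval_finsetSum]
  simp only [eval_mul, eval_C, negXPoch_eval]
  refine Finset.sum_subset (Finset.range_mono h) fun k _ hk => ?_
  rw [← meixnerCoeff, meixnerCoeff_eq_zero, zero_mul]
  simpa using hk

theorem succ_mul_meixnerCoeff (n : ℕ) (β z : ℝ) (k : ℕ) :
    ((n : ℝ) + 1) * meixnerCoeff n β z k = (n + 1 - k) * meixnerCoeff (n + 1) β z k := by
  have h : poch (-((n : ℝ) + 1)) k * (-((n : ℝ) + 1) + k) = -((n : ℝ) + 1) * poch (-n) k := by
    rw [← poch_succ, poch_succ_left]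
    ring_nf
  simp only [meixnerCoeff, Nat.cast_add, Nat.cast_one]
  linear_combination (z ^ k / (k.factorial * poch β k)) * h

theorem meixnerCoeff_succ {β : ℝ} (hβ : 0 < β) (n : ℕ) (z : ℝ) (k : ℕ) :
    ((k : ℝ) + 1) * (β + k) * meixnerCoeff n β z (k + 1) =
      (k - n) * z * meixnerCoeff n β z k := by
  have h1 := (poch_pos hβ k).ne'
  have h2 : (k.factorial : ℝ) ≠ 0 := by positivity
  have h3 : (k : ℝ) + 1 ≠ 0 := by positivity
  have h4 : β + k ≠ 0 := by positivity
  simp only [meixnerCoeff, poch_succ, Nat.factorial_succ, Nat.cast_mul, Nat.cast_succ]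
  field_simp
  ring

theorem mul_poch_one_sub (x : ℝ) (k : ℕ) :
    x * poch (-(x - 1)) k = (x - k) * poch (-x) k := by
  have h := poch_succ_left (-x) k
  rw [poch_succ, show -x + 1 = -(x - 1) by ring] at h
  linarith

theorem meixner_backward_shift (n : ℕ) (β c x : ℝ) :
    x * (meixner (n + 1) β c).eval (x - 1) =
      (x - (n + 1)) * (meixner (n + 1) β c).eval x + (n + 1) * (meixner n β c).eval x := by
  rw [meixner_eval_eq_sum β c _ (show n + 1 < n + 2 by omega),
    meixner_eval_eq_sum β c x (show n + 1 < n + 2 by omega),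
    meixner_eval_eq_sum β c x (show n < n + 2 by omega), Finset.mul_sum, Finset.mul_sum,
    Finset.mul_sum, ← Finset.sum_add_distrib]
  refine Finset.sum_congr rfl fun k _ => ?_
  linear_combination meixnerCoeff (n + 1) β (1 - 1 / c) k * mul_poch_one_sub x k -
    poch (-x) k * succ_mul_meixnerCoeff n β (1 - 1 / c) k

theorem meixner_forward_shift {β : ℝ} (hβ : 0 < β) (n : ℕ) (c x : ℝ) :
    (x + β) * (meixner (n + 1) β c).eval (x + 1) =
      (x + β + (n + 1)) * (meixner (n + 1) β c).eval x -
        (n + 1) / c * (meixner n β c).eval x := by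
  rw [meixner_eval_eq_sum β c _ (show n + 1 < n + 2 by omega),
    meixner_eval_eq_sum β c x (show n + 1 < n + 2 by omega),
    meixner_eval_eq_sum β c x (show n < n + 2 by omega), Finset.mul_sum, Finset.mul_sum,
    Finset.mul_sum, ← Finset.sum_sub_distrib, ← sub_eq_zero, ← Finset.sum_sub_distrib]
  set u : ℕ → ℝ := fun k =>
    (x + β) * meixnerCoeff (n + 1) β (1 - 1 / c) k * (poch (-x) k - poch (-(x + 1)) k) +
      k * meixnerCoeff (n + 1) β (1 - 1 / c) k * poch (-x) k with hu
  have hdiff (k : ℕ) : poch (-(x + 1)) (k + 1) - poch (-x) (k + 1) = -(k + 1) * poch (-x) k := by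
    rw [poch_succ_left, poch_succ, show -(x + 1) + 1 = -x by ring]
    ring
  have hsucc (k : ℕ) : u (k + 1) =
      ((k : ℝ) + 1) * (β + k) * meixnerCoeff (n + 1) β (1 - 1 / c) (k + 1) * poch (-x) k := by
    have h := hdiff k
    have h' := poch_succ (-x) k
    simp only [hu, Nat.cast_succ]
    linear_combination (-(x + β) * meixnerCoeff (n + 1) β (1 - 1 / c) (k + 1)) * h +
      (k + 1) * meixnerCoeff (n + 1) β (1 - 1 / c) (k + 1) * h'
  have htel : ∑ k ∈ Finset.range (n + 2), (u (k + 1) - u k) = 0 := by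
    rw [Finset.sum_range_sub]
    simp [hu, meixnerCoeff_eq_zero, poch]
  rw [← htel]
  refine Finset.sum_congr rfl fun k _ => ?_
  rw [hsucc, meixnerCoeff_succ hβ]
  simp only [hu]
  have h := succ_mul_meixnerCoeff n β (1 - 1 / c) k
  push_cast
  linear_combination (1 / c) * poch (-x) k * h

theorem meixner_recurrence {β : ℝ} (hβ : 0 < β) (n : ℕ) (c x : ℝ) :
    (β + n + 1) * (meixner (n + 2) β c).eval x =
      (x + β + n + 1 - (x - n - 1) / c) * (meixner (n + 1) β c).eval x -
        (n + 1) / c * (meixner n β c).eval x := by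
  have hA := meixner_backward_shift (n + 1) β c (x + 1)
  have hB := meixner_forward_shift hβ (n + 1) c x
  have hB' := meixner_forward_shift hβ n c x
  have hn : (n : ℝ) + 2 ≠ 0 := by positivity
  rw [add_sub_cancel_right] at hA
  push_cast at hA hB
  refine mul_left_cancel₀ hn ?_
  linear_combination (x + β) * hA + (x - n - 1) * hB + (n + 2) * hB'

theorem meixner_zero_eval (β c x : ℝ) : (meixner 0 β c).eval x = 1 := by
  simp [meixner, poch, negXPoch]

theorem meixner_eval_neg_pos {β c : ℝ} (hβ : 0 < β) (hc : 0 < c) (n : ℕ) :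
    0 < (meixner n β c).eval (-β) := by
  induction n with
  | zero => simp [meixner_zero_eval]
  | succ n ih =>
    have h := meixner_forward_shift hβ n c (-β)
    have hn : (n : ℝ) + 1 ≠ 0 := by positivity
    have : (meixner (n + 1) β c).eval (-β) = (meixner n β c).eval (-β) / c := by
      refine mul_left_cancel₀ hn ?_
      linear_combination -h
    rw [this]
    positivity

theorem natDegree_meixner_le (n : ℕ) (β c : ℝ) : (meixner n β c).natDegree ≤ n := by
  refine natDegree_sum_le_of_forall_le _ _ fun k hk => ?_
  refine (natDegree_C_mul_le _ _).trans ?_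
  rw [natDegree_negXPoch]
  exact Nat.lt_succ_iff.1 (Finset.mem_range.1 hk)

theorem coeff_meixner_self_pos {β c : ℝ} (hβ : 0 < β) (hc : 1 < c) (n : ℕ) :
    0 < (meixner n β c).coeff n := by
  have hz : 0 < 1 - 1 / c := sub_pos.2 ((div_lt_one (by linarith)).2 hc)
  have h1 := poch_pos hβ n
  have h2 := neg_one_pow_mul_poch_neg_pos (le_refl n)
  rw [meixner, finsetSum_coeff, Finset.sum_range_succ, Finset.sum_eq_zero, zero_add, coeff_C_mul,
    coeff_negXPoch_self]
  · have : 0 < (-1) ^ n * poch (-(n : ℝ)) n / ((n.factorial : ℝ) * poch β n) *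
        (1 - 1 / c) ^ n := by positivity
    convert this using 1
    ring
  · intro k hk
    rw [coeff_C_mul, coeff_eq_zero_of_natDegree_lt, mul_zero]
    rw [natDegree_negXPoch]
    exact Finset.mem_range.1 hk

theorem natDegree_meixner {β c : ℝ} (hβ : 0 < β) (hc : 1 < c) (n : ℕ) :
    (meixner n β c).natDegree = n :=
  natDegree_eq_of_le_of_coeff_ne_zero (natDegree_meixner_le n β c)
    (coeff_meixner_self_pos hβ hc n).ne'

theorem leadingCoeff_meixner_pos {β c : ℝ} (hβ : 0 < β) (hc : 1 < c) (n : ℕ) :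
    0 < (meixner n β c).leadingCoeff := by
  rw [leadingCoeff, natDegree_meixner hβ hc]
  exact coeff_meixner_self_pos hβ hc n

theorem exists_lt_neg_one_pow_mul_eval_pos {p : Polynomial ℝ} (hp : 0 < p.leadingCoeff)
    (hdeg : 0 < p.natDegree) (a : ℝ) : ∃ x < a, 0 < (-1) ^ p.natDegree * p.eval x := by
  have hlead : (p.comp (-X)).leadingCoeff = p.leadingCoeff * (-1) ^ p.natDegree := by
    rw [leadingCoeff_comp (by simp)]
    simp
  have hs : ((-1 : ℝ) ^ p.natDegree) ≠ 0 := by simp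
  have ht : Tendsto (fun x => (C ((-1 : ℝ) ^ p.natDegree) * p.comp (-X)).eval x) atTop atTop := by
    refine tendsto_atTop_of_leadingCoeff_nonneg _ ?_ ?_
    · rw [← natDegree_pos_iff_degree_pos, natDegree_C_mul hs, natDegree_comp]
      simpa using hdeg
    · rw [leadingCoeff_mul, hlead, leadingCoeff_C, mul_left_comm, ← mul_pow]
      simpa using hp.le
  obtain ⟨x, hx, hxa⟩ := ((ht.eventually_gt_atTop 0).and (eventually_gt_atTop (-a))).exists
  exact ⟨-x, by linarith, by simpa using hx⟩

theorem eq_leadingCoeff_mul_prod_X_sub_C {K : Type*} [Field K] {p : Polynomial K} {n : ℕ}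
    {z : ℕ → K} (hdeg : p.natDegree = n) (hp : p ≠ 0) (hz : Set.InjOn z (Finset.range n))
    (hroot : ∀ i < n, p.eval (z i) = 0) :
    p = C p.leadingCoeff * ∏ i ∈ Finset.range n, (X - C (z i)) := by
  classical
  subst hdeg
  have hmonic : (∏ i ∈ Finset.range p.natDegree, (X - C (z i))).Monic := monic_prod_X_sub_C _ _
  have hlead : p.leadingCoeff ≠ 0 := leadingCoeff_ne_zero.2 hp
  refine eq_of_degree_sub_lt_of_eval_finset_eq ((Finset.range p.natDegree).image z) ?_ ?_
  · rw [Finset.card_image_of_injOn hz, Finset.card_range, ← degree_eq_natDegree hp]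
    refine degree_sub_lt_left ?_ hp ?_
    · rw [degree_C_mul hlead, degree_eq_natDegree hp, degree_eq_natDegree hmonic.ne_zero,
        natDegree_finsetProd_X_sub_C_eq_card, Finset.card_range]
    · rw [leadingCoeff_mul, leadingCoeff_C, hmonic.leadingCoeff, mul_one]
  · simp only [Finset.mem_image, Finset.mem_range]
    rintro _ ⟨i, hi, rfl⟩
    rw [hroot i hi, eval_mul, eval_prod,
      Finset.prod_eq_zero (Finset.mem_range.2 hi) (by simp), mul_zero]

theorem neg_one_pow_mul_prod_sub_pos {n k : ℕ} {x : ℕ → ℝ} {t : ℝ} (hk : k ≤ n)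
    (hlt : ∀ i < k, t < x i) (hgt : ∀ i, k ≤ i → i < n → x i < t) :
    0 < (-1) ^ k * ∏ i ∈ Finset.range n, (t - x i) := by
  rw [← Finset.prod_range_mul_prod_Ico _ hk, ← mul_assoc]
  refine mul_pos ?_ (Finset.prod_pos fun i hi => ?_)
  · have : (-1) ^ k * ∏ i ∈ Finset.range k, (t - x i) = ∏ i ∈ Finset.range k, (x i - t) := by
      rw [← Finset.card_range k, ← Finset.prod_const, Finset.card_range, ← Finset.prod_mul_distrib]
      exact Finset.prod_congr rfl fun i _ => by ring
    rw [this]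
    exact Finset.prod_pos fun i hi => sub_pos.2 (hlt i (Finset.mem_range.1 hi))
  · rw [Finset.mem_Ico] at hi
    exact sub_pos.2 (hgt i hi.1 hi.2)

theorem injOn_range_of_decreasing {n : ℕ} {z : ℕ → ℝ}
    (h : ∀ i j, i < j → j < n → z j < z i) : Set.InjOn z (Finset.range n) := by
  intro i hi j hj hij
  simp only [Finset.coe_range, Set.mem_Iio] at hi hj
  rcases lt_trichotomy i j with hlt | heq | hlt
  · exact absurd hij (h i j hlt hj).ne'
  · exact heq
  · exact absurd hij (h j i hlt hi).ne

/-- `z 0 > z 1 > ⋯ > z (n - 1)` are all the roots of `p`, a polynomial of degree `n`. -/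
structure HasDecreasingRoots (p : Polynomial ℝ) (n : ℕ) (z : ℕ → ℝ) : Prop where
  lt : ∀ i j, i < j → j < n → z j < z i
  eq_prod : p = C p.leadingCoeff * ∏ i ∈ Finset.range n, (X - C (z i))

namespace HasDecreasingRoots

variable {p : Polynomial ℝ} {n : ℕ} {z : ℕ → ℝ}

theorem injOn (h : HasDecreasingRoots p n z) : Set.InjOn z (Finset.range n) :=
  injOn_range_of_decreasing h.lt

theorem eval_eq (h : HasDecreasingRoots p n z) (t : ℝ) :
    p.eval t = p.leadingCoeff * ∏ i ∈ Finset.range n, (t - z i) := by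
  conv_lhs => rw [h.eq_prod]
  simp [eval_prod]

theorem isRoot_iff (h : HasDecreasingRoots p n z) (hp : p ≠ 0) (t : ℝ) :
    p.IsRoot t ↔ ∃ i < n, t = z i := by
  simp [IsRoot.def, h.eval_eq, hp, Finset.prod_eq_zero_iff, sub_eq_zero]

theorem neg_one_pow_mul_eval_pos (h : HasDecreasingRoots p n z) (hp : 0 < p.leadingCoeff)
    {k : ℕ} {t : ℝ} (hk : k ≤ n) (hlt : ∀ i < k, t < z i) (hgt : ∀ i, k ≤ i → i < n → z i < t) :
    0 < (-1) ^ k * p.eval t := by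
  rw [h.eval_eq, mul_left_comm]
  exact mul_pos hp (neg_one_pow_mul_prod_sub_pos hk hlt hgt)

theorem neg_one_pow_mul_eval_nonneg (h : HasDecreasingRoots p n z) (hp : 0 < p.leadingCoeff)
    {k : ℕ} {t : ℝ} (hk : k ≤ n) (hlt : ∀ i < k, t < z i) (hge : ∀ i, k ≤ i → i < n → z i ≤ t) :
    0 ≤ (-1) ^ k * p.eval t := by
  by_cases hroot : p.eval t = 0
  · simp [hroot]
  · refine (h.neg_one_pow_mul_eval_pos hp hk hlt fun i hki hi => (hge i hki hi).lt_of_ne ?_).le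
    rintro rfl
    exact hroot ((h.isRoot_iff (leadingCoeff_ne_zero.1 hp.ne') _).2 ⟨i, hi, rfl⟩)

theorem rootMultiplicity_eq_one (h : HasDecreasingRoots p n z) (hp : p ≠ 0) {i : ℕ}
    (hi : i < n) : p.rootMultiplicity (z i) = 1 := by
  have hsep : p.Separable := by
    rw [h.eq_prod]
    exact Separable.unit_mul (isUnit_C.2 (isUnit_iff_ne_zero.2 (leadingCoeff_ne_zero.2 hp)))
      (separable_prod_X_sub_C_iff'.2 fun a ha b hb hab => h.injOn (by simpa using ha)
        (by simpa using hb) hab)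
  exact le_antisymm (rootMultiplicity_le_one_of_separable hsep _)
    ((rootMultiplicity_pos hp).2 ((h.isRoot_iff hp _).2 ⟨i, hi, rfl⟩))

theorem isRootTuple (h : HasDecreasingRoots p n z) (hp : p ≠ 0) :
    IsRootTuple p fun j : Fin n => z (n - 1 - j) := by
  refine ⟨fun i j hij => h.lt _ _ (by omega) (by omega), fun y => ?_⟩
  rw [h.isRoot_iff hp]
  constructor
  · rintro ⟨i, hi, rfl⟩
    exact ⟨⟨n - 1 - i, by omega⟩, congrArg z (show i = n - 1 - (n - 1 - i) by omega)⟩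
  · rintro ⟨j, rfl⟩
    exact ⟨n - 1 - j, by omega, rfl⟩

end HasDecreasingRoots

theorem IsRootTuple.unique {n : ℕ} {p : Polynomial ℝ} {x y : Fin n → ℝ} (hx : IsRootTuple p x)
    (hy : IsRootTuple p y) : x = y := by
  refine (StrictMono.range_inj hx.1 hy.1).1 (Set.ext fun t => ?_)
  simp only [Set.mem_range, eq_comm (b := t)]
  rw [← hx.2, ← hy.2]

theorem meixner_interlacing_sign {β c : ℝ} (hβ : 0 < β) (hc : 1 < c) {n : ℕ} {x y : ℕ → ℝ}
    (hx : HasDecreasingRoots (meixner (n + 1) β c) (n + 1) x)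
    (hy : HasDecreasingRoots (meixner n β c) n y)
    (hxy : ∀ i < n, x (i + 1) < y i ∧ y i < x i) (i : ℕ) (hi : i < n + 1) :
    0 < (-1) ^ i * (meixner n β c).eval (x i) := by
  refine hy.neg_one_pow_mul_eval_pos (leadingCoeff_meixner_pos hβ hc n) (by omega)
    (fun j hj => ?_) (fun j hij hj => ?_)
  · have := (hxy j (by omega)).1
    rcases (show j + 1 ≤ i from hj).eq_or_lt with rfl | h
    · exact this
    · exact (hx.lt _ _ h hi).trans this
  · have := (hxy j hj).2
    rcases hij.eq_or_lt with rfl | h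
    · exact this
    · exact this.trans (hx.lt _ _ h (by omega))

theorem exists_meixner_roots {β c : ℝ} (hβ : 0 < β) (hc : 1 < c) (n : ℕ) :
    ∃ x y : ℕ → ℝ, HasDecreasingRoots (meixner (n + 1) β c) (n + 1) x ∧
      HasDecreasingRoots (meixner n β c) n y ∧ (∀ i < n + 1, x i < -β) ∧
      (∀ i < n, x (i + 1) < y i ∧ y i < x i) := by
  have hc0 : 0 < c := by linarith
  have hroots (m : ℕ) (w : ℕ → ℝ) (hw : ∀ i j, i < j → j < m + 1 → w j < w i)
      (hsign : ∀ i < m + 1, 0 < (-1) ^ i * (meixner m β c).eval (w i)) :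
      ∃ z, HasDecreasingRoots (meixner m β c) m z ∧ ∀ i < m, w (i + 1) < z i ∧ z i < w i := by
    have hex (i : ℕ) : ∃ t, i < m →
        (w (i + 1) < t ∧ t < w i) ∧ (meixner m β c).eval t = 0 := by
      by_cases hi : i < m
      · have h1 := hsign i (by omega)
        have h2 := hsign (i + 1) (by omega)
        rw [pow_succ] at h2
        obtain ⟨t, ht, ht0⟩ := intermediate_value_Ioo (hw i (i + 1) (by omega) (by omega)).le
          (f := fun t => (-1) ^ i * (meixner m β c).eval t)
          (by fun_prop) (show (0 : ℝ) ∈ Set.Ioo _ _ from ⟨by linarith, h1⟩)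
        exact ⟨t, fun _ => ⟨ht, by simpa using ht0⟩⟩
      · exact ⟨0, fun h => absurd h hi⟩
    choose z hz using hex
    have hlt : ∀ i j, i < j → j < m → z j < z i := by
      intro i j hij hj
      have h1 := (hz j hj).1.2
      have h2 := (hz i (by omega)).1.1
      rcases (show i + 1 ≤ j from hij).eq_or_lt with rfl | h
      · linarith
      · linarith [hw _ _ h (by omega)]
    refine ⟨z, ⟨hlt, ?_⟩, fun i hi => (hz i hi).1⟩
    exact eq_leadingCoeff_mul_prod_X_sub_C (natDegree_meixner hβ hc m)
      (leadingCoeff_ne_zero.1 (leadingCoeff_meixner_pos hβ hc m).ne')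
      (injOn_range_of_decreasing hlt) fun i hi => (hz i hi).2
  have hbot (m : ℕ) (a : ℝ) : ∃ t < a, 0 < (-1) ^ (m + 1) * (meixner (m + 1) β c).eval t := by
    have h := exists_lt_neg_one_pow_mul_eval_pos (leadingCoeff_meixner_pos hβ hc (m + 1))
      (by rw [natDegree_meixner hβ hc]; omega) a
    rwa [natDegree_meixner hβ hc] at h
  induction n with
  | zero =>
    obtain ⟨b, hb, hbs⟩ := hbot 0 (-β)
    obtain ⟨x, hx, hxw⟩ := hroots 1 (fun i => if i = 0 then -β else b)
      (fun i j hij hj => by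
        obtain ⟨rfl, rfl⟩ : i = 0 ∧ j = 1 := by omega
        simpa using hb)
      (fun i hi => by
        obtain rfl | rfl : i = 0 ∨ i = 1 := by omega
        · simpa using meixner_eval_neg_pos hβ hc0 1
        · simpa using hbs)
    obtain ⟨y, hy, -⟩ := hroots 0 (fun _ => 0) (fun i j hij hj => by omega)
      (fun i hi => by
        obtain rfl : i = 0 := by omega
        simp [meixner_zero_eval])
    refine ⟨x, y, hx, hy, fun i hi => ?_, fun i hi => by omega⟩
    obtain rfl : i = 0 := by omega
    simpa using (hxw 0 (by omega)).2
  | succ n ih =>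
    obtain ⟨x, y, hx, hy, hxβ, hxy⟩ := ih
    have hsx (i : ℕ) (hi : i < n + 1) :
        0 < (-1) ^ (i + 1) * (meixner (n + 2) β c).eval (x i) := by
      have hroot : (meixner (n + 1) β c).eval (x i) = 0 :=
        (hx.isRoot_iff (leadingCoeff_ne_zero.1 (leadingCoeff_meixner_pos hβ hc _).ne') _).2
          ⟨i, hi, rfl⟩
      have hy0 := meixner_interlacing_sign hβ hc hx hy hxy i hi
      have hrec := meixner_recurrence hβ n c (x i)
      rw [hroot, mul_zero, zero_sub] at hrec
      refine pos_of_mul_pos_right (a := β + n + 1) ?_ (by positivity)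
      have : (β + n + 1) * ((-1) ^ (i + 1) * (meixner (n + 2) β c).eval (x i)) =
          (n + 1) / c * ((-1) ^ i * (meixner n β c).eval (x i)) := by
        rw [pow_succ]
        linear_combination (-(-1) ^ i) * hrec
      rw [this]
      positivity
    obtain ⟨b, hb, hbs⟩ := hbot (n + 1) (x n)
    set w : ℕ → ℝ := fun i => if i = 0 then -β else if i = n + 2 then b else x (i - 1) with hw
    have hw0 : w 0 = -β := by simp [hw]
    have hwb : w (n + 2) = b := by simp [hw]
    have hwx (i : ℕ) (hi : i < n + 1) : w (i + 1) = x i := by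
      have : i ≠ n + 1 := by omega
      simp [hw, this]
    have hxb (i : ℕ) (hi : i < n + 1) : b < x i := by
      rcases (Nat.lt_succ_iff.1 hi).eq_or_lt with rfl | h
      · exact hb
      · exact hb.trans (hx.lt _ _ h (by omega))
    obtain ⟨z, hz, hzw⟩ := hroots (n + 2) w
      (fun i j hij hj => by
        obtain ⟨j, rfl⟩ : ∃ k, j = k + 1 := ⟨j - 1, by omega⟩
        have hjb : j < n + 1 ∨ j = n + 1 := by omega
        rcases i with _ | i
        · rw [hw0]
          rcases hjb with h | rfl
          · rw [hwx j h]
            exact hxβ j h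
          · rw [hwb]
            exact (hxb 0 (by omega)).trans (hxβ 0 (by omega))
        · rw [hwx i (by omega)]
          rcases hjb with h | rfl
          · rw [hwx j h]
            exact hx.lt i j (by omega) h
          · rw [hwb]
            exact hxb i (by omega))
      (fun i hi => by
        rcases i with _ | i
        · rw [hw0]
          simpa using meixner_eval_neg_pos hβ hc0 (n + 2)
        · obtain h | rfl : i < n + 1 ∨ i = n + 1 := by omega
          · rw [hwx i h]
            exact hsx i h
          · rw [hwb]
            exact hbs)
    refine ⟨z, x, hz, hx, fun i hi => ?_, fun i hi => ?_⟩
    · have h := (hzw i hi).2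
      rcases i with _ | i
      · rwa [hw0] at h
      · rw [hwx i (by omega)] at h
        exact h.trans (hxβ i (by omega))
    · have h1 := (hzw i (by omega)).1
      have h2 := (hzw (i + 1) (by omega)).2
      rw [hwx i hi] at h1 h2
      exact ⟨h2, h1⟩

theorem meixner_roots_gap {β c : ℝ} (hβ : 0 < β) (hc : 1 < c) {n : ℕ} {x y : ℕ → ℝ}
    (hx : HasDecreasingRoots (meixner (n + 1) β c) (n + 1) x)
    (hy : HasDecreasingRoots (meixner n β c) n y) (hxβ : ∀ i < n + 1, x i < -β)
    (hxy : ∀ i < n, x (i + 1) < y i ∧ y i < x i) (i : ℕ) (hi : i < n) :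
    x (i + 1) + 1 < x i := by
  have hc0 : 0 < c := by linarith
  have hlead := leadingCoeff_meixner_pos hβ hc (n + 1)
  have hroot (j : ℕ) (hj : j < n + 1) : (meixner (n + 1) β c).eval (x j) = 0 :=
    (hx.isRoot_iff (leadingCoeff_ne_zero.1 hlead.ne') _).2 ⟨j, hj, rfl⟩
  have hsign (i : ℕ) (hi : i < n) :
      (-1) ^ i * (meixner (n + 1) β c).eval (x (i + 1) + 1) < 0 := by
    have hpos := meixner_interlacing_sign hβ hc hx hy hxy (i + 1) (by omega)
    have hshift := meixner_forward_shift hβ n c (x (i + 1))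
    rw [hroot (i + 1) (by omega), mul_zero, zero_sub] at hshift
    have hneg : 0 < -(x (i + 1) + β) := by linarith [hxβ (i + 1) (by omega)]
    rw [← neg_pos]
    refine pos_of_mul_pos_right (a := -(x (i + 1) + β)) ?_ hneg.le
    have : -(x (i + 1) + β) * -((-1) ^ i * (meixner (n + 1) β c).eval (x (i + 1) + 1)) =
        (n + 1) / c * ((-1) ^ (i + 1) * (meixner n β c).eval (x (i + 1))) := by
      rw [pow_succ]
      linear_combination (-1) ^ i * hshift
    rw [this]
    positivity
  induction i with
  | zero =>
    by_contra! h
    have hs := hsign 0 hi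
    refine absurd (hx.neg_one_pow_mul_eval_nonneg hlead (Nat.zero_le _) (fun j hj => by omega)
      (fun j _ hj => ?_)) (not_le.2 hs)
    rcases Nat.eq_zero_or_pos j with rfl | h0
    · exact h
    · exact (hx.lt 0 j h0 hj).le.trans h
  | succ i ih =>
    by_contra! h
    have hs := hsign (i + 1) hi
    have hgap := ih (by omega)
    refine absurd (hx.neg_one_pow_mul_eval_nonneg hlead (by omega) (fun j hj => ?_)
      (fun j hij hj => ?_)) (not_le.2 hs)
    · have h1 : x (i + 1 + 1) < x (i + 1) := hx.lt _ _ (by omega) (by omega)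
      rcases (Nat.lt_succ_iff.1 hj).eq_or_lt with rfl | h0
      · linarith
      · linarith [hx.lt j i h0 (by omega)]
    · rcases hij.eq_or_lt with rfl | h0
      · exact h
      · exact (hx.lt _ _ h0 hj).le.trans h

/-- for nonstandard parameters `β > 0`, `c > 1`, the Meixner polynomial
`M_n(·;β,c)` has `n` simple real roots in `(−∞,−β)` with mutual distances greater than `1`,
and the roots of `M_n` and `M_{n-1}` interlace. -/
theorem meixner_nonstandard_roots
    (β c : ℝ) (hβ : 0 < β) (hc : 1 < c) (n : ℕ) (hn : 1 ≤ n) :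
    (∃ x : Fin n → ℝ, IsRootTuple (meixner n β c) x ∧
      (∀ j, (meixner n β c).rootMultiplicity (x j) = 1) ∧
      (∀ j, x j < -β) ∧
      (∀ j k, j ≠ k → |x j - x k| > 1)) ∧
    (∀ x : Fin n → ℝ, ∀ y : Fin (n - 1) → ℝ,
      IsRootTuple (meixner n β c) x → IsRootTuple (meixner (n - 1) β c) y →
      ∀ j : ℕ, ∀ hj : j < n - 1,
        x ⟨j, by omega⟩ < y ⟨j, hj⟩ ∧ y ⟨j, hj⟩ < x ⟨j + 1, by omega⟩) := by
  obtain ⟨n, rfl⟩ : ∃ m, n = m + 1 := ⟨n - 1, by omega⟩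
  obtain ⟨x, y, hx, hy, hxβ, hxy⟩ := exists_meixner_roots hβ hc n
  have hne (m : ℕ) : meixner m β c ≠ 0 :=
    leadingCoeff_ne_zero.1 (leadingCoeff_meixner_pos hβ hc m).ne'
  have hgap (i j : ℕ) (hij : i < j) (hj : j < n + 1) : x j + 1 < x i := by
    have h := meixner_roots_gap hβ hc hx hy hxβ hxy i (by omega)
    rcases (show i + 1 ≤ j from hij).eq_or_lt with rfl | hlt
    · exact h
    · linarith [hx.lt _ _ hlt hj]
  refine ⟨⟨_, hx.isRootTuple (hne _), fun j => hx.rootMultiplicity_eq_one (hne _) (by omega),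
    fun j => hxβ _ (by omega), fun j k hjk => ?_⟩, fun u v hu hv j hj => ?_⟩
  · rcases lt_or_gt_of_ne hjk with h | h
    · have := hgap (n + 1 - 1 - k) (n + 1 - 1 - j) (by omega) (by omega)
      rw [abs_sub_comm]
      exact lt_of_lt_of_le (by linarith) (le_abs_self _)
    · have := hgap (n + 1 - 1 - j) (n + 1 - 1 - k) (by omega) (by omega)
      exact lt_of_lt_of_le (by linarith) (le_abs_self _)
  · obtain rfl := hu.unique (hx.isRootTuple (hne _))
    obtain rfl := IsRootTuple.unique (n := n) hv (hy.isRootTuple (hne _))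
    have hj' : j < n := hj
    have h := hxy (n - 1 - j) (by omega)
    rw [show n - 1 - j + 1 = n - j by omega] at h
    refine ⟨h.1, ?_⟩
    convert h.2 using 2
    simp only
    omega
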